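/- arXiv:2506.00436 — 2 statements merged into one kernel-verified Lean document; each statement's English description precedes it below -/
import Mathlib

section
/- (Lemma 1.) Assume 0 < P(W = +1) < 1, P(Y = +1) > 0 and P(Y = +1, Z = +1) > 0, and let g : 𝒳 → ℝ be measurable. Then the zero-one classification risk R₀₋₁(g) = α · E_{W=+1}[ℓ₀₋₁(g(X))] + (1 − α) · E_{W=−1}[ℓ₀₋₁(−g(X))] satisfies R₀₋₁(g) = β · E_{Y=+1}[ℓ₀₋₁(g(X))] − γ · E_{(Y,Z)=(+1,+1)}[ℓ₀₋₁(g(X))] + E[ℓ₀₋₁(−g(X))] − β · E_{Y=+1}[ℓ₀₋₁(−g(X))] + γ · E_{(Y,Z)=(+1,+1)}[ℓ₀₋₁(−g(X))], where E[·] is the unconditional expectation. -/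
open MeasureTheory ProbabilityTheory

/-- The zero-one loss `ℓ₀₋₁(z) = (1/2)·sgn(−z) + 1/2`, where `sgn(u) = 1` if `u > 0`,
`sgn(u) = −1` if `u < 0`, and `sgn(0) = 0`. (`Real.sign` is exactly this `sgn`.) -/
noncomputable def zeroOneLoss (z : ℝ) : ℝ := (1 / 2) * Real.sign (-z) + 1 / 2

lemma Real.measurable_sign : Measurable Real.sign :=
  Measurable.ite measurableSet_Iio measurable_const
    (Measurable.ite measurableSet_Ioi measurable_const measurable_const)

lemma measurable_zeroOneLoss : Measurable zeroOneLoss :=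
  ((Real.measurable_sign.comp measurable_neg).const_mul _).add_const _

lemma norm_zeroOneLoss_le_one (z : ℝ) : ‖zeroOneLoss z‖ ≤ 1 := by
  unfold zeroOneLoss
  rcases Real.sign_apply_eq (-z) with h | h | h <;> rw [h] <;> norm_num

lemma integrable_zeroOneLoss_comp {Ω : Type*} [MeasurableSpace Ω] {P : Measure Ω}
    [IsFiniteMeasure P] {f : Ω → ℝ} (hf : Measurable f) :
    Integrable (fun ω => zeroOneLoss (f ω)) P :=
  .of_bound (measurable_zeroOneLoss.comp hf).aestronglyMeasurable 1
    (.of_forall fun _ => norm_zeroOneLoss_le_one _)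

lemma toReal_mul_integral_cond {Ω : Type*} [MeasurableSpace Ω] (P : Measure Ω)
    [IsFiniteMeasure P] (s : Set Ω) (f : Ω → ℝ) :
    (P s).toReal * ∫ ω, f ω ∂(P[|s]) = ∫ ω in s, f ω ∂P := by
  rcases eq_or_ne (P s) 0 with h | h
  · simp [h, Measure.restrict_eq_zero.2 h]
  · have h' : (P s).toReal ≠ 0 := ENNReal.toReal_ne_zero.2 ⟨h, measure_ne_top P s⟩
    rw [ProbabilityTheory.cond, integral_smul_measure, ENNReal.toReal_inv, smul_eq_mul,
      mul_inv_cancel_left₀ h']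

/-- Lemma 1: Assume `0 < P(W = +1) < 1`, `P(Y = +1) > 0` and
`P(Y = +1, Z = +1) > 0`, and let `g : 𝒳 → ℝ` be measurable. Then the zero-one risk
`R₀₋₁(g) = α·E_{W=+1}[ℓ₀₋₁(g(X))] + (1−α)·E_{W=−1}[ℓ₀₋₁(−g(X))]` satisfies
`R₀₋₁(g) = β·E_{Y=+1}[ℓ₀₋₁(g(X))] − γ·E_{(Y,Z)=(+1,+1)}[ℓ₀₋₁(g(X))] + E[ℓ₀₋₁(−g(X))]
  − β·E_{Y=+1}[ℓ₀₋₁(−g(X))] + γ·E_{(Y,Z)=(+1,+1)}[ℓ₀₋₁(−g(X))]`. -/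
theorem double_pu_lemma1_zero_one_risk
    {Ω 𝓧 : Type*} [MeasurableSpace Ω] [MeasurableSpace 𝓧]
    (P : Measure Ω) [IsProbabilityMeasure P]
    (X : Ω → 𝓧) (Y Z W : Ω → ℤ)
    (hX : Measurable X) (hY : Measurable Y) (hZ : Measurable Z)
    (hYval : ∀ ω, Y ω = 1 ∨ Y ω = -1) (hZval : ∀ ω, Z ω = 1 ∨ Z ω = -1)
    (hW : ∀ ω, W ω = if Y ω = 1 ∧ Z ω = -1 then 1 else -1)
    (hα0 : 0 < P {ω | W ω = 1}) (hα1 : P {ω | W ω = 1} < 1)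
    (hβ : 0 < P {ω | Y ω = 1})
    (hγ : 0 < P ({ω | Y ω = 1} ∩ {ω | Z ω = 1}))
    (g : 𝓧 → ℝ) (hg : Measurable g) :
    (P {ω | W ω = 1}).toReal * ∫ ω, zeroOneLoss (g (X ω)) ∂(P[|{ω | W ω = 1}])
      + (1 - (P {ω | W ω = 1}).toReal)
          * ∫ ω, zeroOneLoss (-(g (X ω))) ∂(P[|{ω | W ω = -1}])
    = (P {ω | Y ω = 1}).toReal * ∫ ω, zeroOneLoss (g (X ω)) ∂(P[|{ω | Y ω = 1}])
      - (P ({ω | Y ω = 1} ∩ {ω | Z ω = 1})).toReal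
          * ∫ ω, zeroOneLoss (g (X ω)) ∂(P[|({ω | Y ω = 1} ∩ {ω | Z ω = 1})])
      + ∫ ω, zeroOneLoss (-(g (X ω))) ∂P
      - (P {ω | Y ω = 1}).toReal * ∫ ω, zeroOneLoss (-(g (X ω))) ∂(P[|{ω | Y ω = 1}])
      + (P ({ω | Y ω = 1} ∩ {ω | Z ω = 1})).toReal
          * ∫ ω, zeroOneLoss (-(g (X ω))) ∂(P[|({ω | Y ω = 1} ∩ {ω | Z ω = 1})]) := by
  have hYs : MeasurableSet {ω | Y ω = 1} := hY (measurableSet_singleton 1)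
  have hYZs : MeasurableSet ({ω | Y ω = 1} ∩ {ω | Z ω = 1}) :=
    hYs.inter (hZ (measurableSet_singleton 1))
  have hWpos : {ω | W ω = 1} = {ω | Y ω = 1} \ ({ω | Y ω = 1} ∩ {ω | Z ω = 1}) := by
    ext ω
    simp only [Set.mem_ofPred_eq, Set.mem_sdiff, Set.mem_inter_iff]
    grind
  have hWneg : {ω | W ω = -1} = {ω | W ω = 1}ᶜ := by
    ext ω
    simp only [Set.mem_ofPred_eq, Set.mem_compl_iff]
    grind
  have hWs : MeasurableSet {ω | W ω = 1} := hWpos ▸ hYs.diff hYZs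
  have hα : 1 - (P {ω | W ω = 1}).toReal = (P {ω | W ω = -1}).toReal := by
    rw [hWneg]
    exact (probReal_compl_eq_one_sub hWs).symm
  have hpos : Integrable (fun ω => zeroOneLoss (g (X ω))) P :=
    integrable_zeroOneLoss_comp (hg.comp hX)
  have hneg : Integrable (fun ω => zeroOneLoss (-(g (X ω)))) P :=
    integrable_zeroOneLoss_comp (hg.comp hX).neg
  rw [hα]
  simp only [toReal_mul_integral_cond]
  rw [hWneg, setIntegral_compl hWs hneg, hWpos,
    setIntegral_sdiff hYZs hpos.integrableOn Set.inter_subset_left,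
    setIntegral_sdiff hYZs hneg.integrableOn Set.inter_subset_left]
  ring
end

section
/- Suppose {S = 1} ⊆ {Y = +1}, {T = 1} ⊆ {S = 1}, and S is selected completely at random among Y = +1, i.e. P(S = 1 | X = x, Y = +1) = P(S = 1 | Y = +1) for all x ∈ 𝒳 with P(X = x, Y = +1) > 0. Then for every x ∈ 𝒳 with P(X = x, S = 1) > 0, P(T = 1 | X = x, S = 1) = P(T = 1 | X = x, Y = +1) / P(S = 1 | Y = +1). -/
open MeasureTheory

/-- Conditional probability `P(A | B) = P(A ∩ B) / P(B)` as a real number. -/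
noncomputable def cpr {Ω : Type*} [MeasurableSpace Ω] (P : Measure Ω) (A B : Set Ω) : ℝ :=
  (P (A ∩ B)).toReal / (P B).toReal

/-- Suppose `{S = 1} ⊆ {Y = +1}`, `{T = 1} ⊆ {S = 1}`, and `S` is selected
completely at random among `Y = +1`, i.e. `P(S = 1 | X = x, Y = +1) = P(S = 1 | Y = +1)`
whenever `P(X = x, Y = +1) > 0`. Then for every `x` with `P(X = x, S = 1) > 0`,
`P(T = 1 | X = x, S = 1) = P(T = 1 | X = x, Y = +1) / P(S = 1 | Y = +1)`. -/
theorem scar_conditional_label_probability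
    {Ω 𝓧 : Type*} [MeasurableSpace Ω] [Countable 𝓧]
    (P : Measure Ω) [IsProbabilityMeasure P]
    (X : Ω → 𝓧) (Y Z : Ω → ℤ) (S T : Ω → ℕ)
    (hSval : ∀ ω, S ω = 0 ∨ S ω = 1) (hTval : ∀ ω, T ω = 0 ∨ T ω = 1)
    (hSY : {ω | S ω = 1} ⊆ {ω | Y ω = 1})
    (hTS : {ω | T ω = 1} ⊆ {ω | S ω = 1})
    (hYpos : 0 < P {ω | Y ω = 1})
    (hSCAR : ∀ x : 𝓧, 0 < P ({ω | X ω = x} ∩ {ω | Y ω = 1}) →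
      cpr P {ω | S ω = 1} ({ω | X ω = x} ∩ {ω | Y ω = 1})
        = cpr P {ω | S ω = 1} {ω | Y ω = 1}) :
    ∀ x : 𝓧, 0 < P ({ω | X ω = x} ∩ {ω | S ω = 1}) →
      cpr P {ω | T ω = 1} ({ω | X ω = x} ∩ {ω | S ω = 1})
        = cpr P {ω | T ω = 1} ({ω | X ω = x} ∩ {ω | Y ω = 1})
          / cpr P {ω | S ω = 1} {ω | Y ω = 1} := by
  intro x hx
  have hXS : {ω | X ω = x} ∩ {ω | S ω = 1} ⊆ {ω | X ω = x} ∩ {ω | Y ω = 1} :=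
    Set.inter_subset_inter_right _ hSY
  have hXY : 0 < P ({ω | X ω = x} ∩ {ω | Y ω = 1}) := hx.trans_le (measure_mono hXS)
  have hS : {ω | S ω = 1} ∩ ({ω | X ω = x} ∩ {ω | Y ω = 1})
      = {ω | X ω = x} ∩ {ω | S ω = 1} := by
    rw [Set.inter_left_comm, Set.inter_eq_left.mpr hSY]
  have hT : {ω | T ω = 1} ∩ ({ω | X ω = x} ∩ {ω | S ω = 1})
      = {ω | T ω = 1} ∩ ({ω | X ω = x} ∩ {ω | Y ω = 1}) := by
    rw [Set.inter_left_comm, Set.inter_eq_left.mpr hTS, Set.inter_left_comm {ω | T ω = 1},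
      Set.inter_eq_left.mpr (hTS.trans hSY)]
  have hXY_ne : (P ({ω | X ω = x} ∩ {ω | Y ω = 1})).toReal ≠ 0 :=
    (ENNReal.toReal_pos hXY.ne' (measure_ne_top _ _)).ne'
  rw [← hSCAR x hXY]
  unfold cpr
  rw [hS, hT, div_div_div_cancel_right₀ hXY_ne]
end
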